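/- arXiv:1611.09152 — 5 statements merged into one kernel-verified Lean document; each statement's English description precedes it below -/
import Mathlib

section
/- Let M ≥ 1, let n ≥ 1, let h₁, …, h_n ∈ ℂ^M with h₁ ≠ 0, and let Z ∈ ℂ^{M×M} be Hermitian positive definite. Set B = Σ_{i=2}^{n} h_i h_i^H + Z (Hermitian positive definite). Then for every nonzero v ∈ ℂ^M, |v^H h₁|² / (v^H B v) ≤ h₁^H B^{-1} h₁ (both sides real), and equality is achieved by the multicell MMSE combining vector v = (Σ_{i=1}^{n} h_i h_i^H + Z)^{-1} h₁, which is nonzero. -/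
open Matrix
open scoped ComplexOrder

/-- The rank-one outer product `h hᴴ` of a column vector `h`. -/
noncomputable def outer {M : ℕ} (h : Fin M → ℂ) : Matrix (Fin M) (Fin M) ℂ :=
  Matrix.vecMulVec h (star h)

theorem aux_herm {M : ℕ} {B : Matrix (Fin M) (Fin M) ℂ} (hB : B.IsHermitian) (x y : Fin M → ℂ) :
    star x ⬝ᵥ (B *ᵥ y) = star (star y ⬝ᵥ (B *ᵥ x)) := by
  rw [Matrix.star_dotProduct, Matrix.star_mulVec, hB.eq, Matrix.dotProduct_mulVec]

theorem aux_real {M : ℕ} {B : Matrix (Fin M) (Fin M) ℂ} (hB : B.PosDef) {x : Fin M → ℂ}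
    (hx : x ≠ 0) : ∃ p : ℝ, 0 < p ∧ star x ⬝ᵥ (B *ᵥ x) = (p : ℂ) := by
  have h := hB.dotProduct_mulVec_pos hx
  rw [Complex.lt_def] at h
  refine ⟨_, h.1, ?_⟩
  apply Complex.ext
  · simp
  · simpa using h.2.symm

/-- optimality of multicell MMSE combining.
With channel estimates `h 0, …, h (n-1)` (where `h 0` plays the role of the desired
user's estimate `h₁` and is nonzero) and Hermitian positive definite `Z`, set
`B = Σ_{i ≠ 0} (h i)(h i)ᴴ + Z`. Then for every nonzero `v`,
`|vᴴ h₁|² / (vᴴ B v) ≤ h₁ᴴ B⁻¹ h₁` (both sides real), with equality at the M-MMSE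
combining vector `v = (Σ_i (h i)(h i)ᴴ + Z)⁻¹ h₁`, which is nonzero. -/
theorem multicell_mmse_combining_maximizes_rayleigh_quotient
    {M n : ℕ} (hM : 1 ≤ M) (hn : 1 ≤ n) (h : Fin n → (Fin M → ℂ)) (hh₁ : h ⟨0, hn⟩ ≠ 0)
    (Z : Matrix (Fin M) (Fin M) ℂ) (hZ : Z.PosDef)
    (B : Matrix (Fin M) (Fin M) ℂ)
    (hB : B = (∑ i ∈ Finset.univ.filter (fun i => i ≠ ⟨0, hn⟩), outer (h i)) + Z) :
    B.PosDef ∧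
    (star (h ⟨0, hn⟩) ⬝ᵥ (B⁻¹ *ᵥ h ⟨0, hn⟩)).im = 0 ∧
    (∀ v : Fin M → ℂ, v ≠ 0 →
      (star v ⬝ᵥ (B *ᵥ v)).im = 0 ∧
      ‖star v ⬝ᵥ h ⟨0, hn⟩‖ ^ 2 / (star v ⬝ᵥ (B *ᵥ v)).re ≤
        (star (h ⟨0, hn⟩) ⬝ᵥ (B⁻¹ *ᵥ h ⟨0, hn⟩)).re) ∧
    (∀ v : Fin M → ℂ, v = ((∑ i, outer (h i)) + Z)⁻¹ *ᵥ h ⟨0, hn⟩ →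
      v ≠ 0 ∧
      ‖star v ⬝ᵥ h ⟨0, hn⟩‖ ^ 2 / (star v ⬝ᵥ (B *ᵥ v)).re =
        (star (h ⟨0, hn⟩) ⬝ᵥ (B⁻¹ *ᵥ h ⟨0, hn⟩)).re) := by
  have hBp : B.PosDef := by
    rw [hB]
    exact Matrix.PosDef.posSemidef_add
      (Matrix.posSemidef_sum _ fun i _ => Matrix.posSemidef_vecMulVec_self_star (h i)) hZ
  have hA : (∑ i, outer (h i)) + Z = outer (h ⟨0, hn⟩) + B := by
    rw [hB, ← add_assoc, Finset.filter_ne', Finset.add_sum_erase _ (fun i => outer (h i)) (Finset.mem_univ _)]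
  have hAp : (outer (h ⟨0, hn⟩) + B).PosDef :=
    Matrix.PosDef.posSemidef_add (Matrix.posSemidef_vecMulVec_self_star _) hBp
  rw [hA]
  clear hA hB
  generalize h ⟨0, hn⟩ = g at *
  have hBd : IsUnit B.det := (Matrix.isUnit_iff_isUnit_det _).1 hBp.isUnit
  have hAd : IsUnit (outer g + B).det := (Matrix.isUnit_iff_isUnit_det _).1 hAp.isUnit
  obtain ⟨u, hu⟩ : ∃ u, u = B⁻¹ *ᵥ g := ⟨_, rfl⟩
  have hBu : B *ᵥ u = g := by
    rw [hu, Matrix.mulVec_mulVec, Matrix.mul_nonsing_inv _ hBd, Matrix.one_mulVec]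
  have hu0 : u ≠ 0 := by
    rintro rfl
    exact hh₁ (by simpa using hBu.symm)
  obtain ⟨q, hq, hqe⟩ := aux_real hBp hu0
  have hgu : star g ⬝ᵥ u = (q : ℂ) := by
    have := aux_herm hBp.1 u u
    rw [← hqe, this, hBu, Matrix.star_dotProduct]
  rw [← hu, hgu]
  refine ⟨hBp, by simp, ?_, ?_⟩
  · intro v hv
    obtain ⟨p, hp, hpe⟩ := aux_real hBp hv
    rw [hpe]
    refine ⟨by simp, ?_⟩
    obtain ⟨c, hc⟩ : ∃ c, c = star v ⬝ᵥ g := ⟨_, rfl⟩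
    have hvu : star v ⬝ᵥ (B *ᵥ u) = c := by rw [hBu, hc]
    have huv : star u ⬝ᵥ (B *ᵥ v) = star c := by rw [aux_herm hBp.1, hvu]
    have key := hBp.posSemidef.dotProduct_mulVec_nonneg (u - (c / p) • v)
    have hpc : (p : ℂ) ≠ 0 := by exact_mod_cast hp.ne'
    have e : star (u - (c / p) • v) ⬝ᵥ (B *ᵥ (u - (c / p) • v))
        = ((q - ‖c‖ ^ 2 / p : ℝ) : ℂ) := by
      simp only [star_sub, star_smul, Matrix.mulVec_sub, Matrix.mulVec_smul, sub_dotProduct,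
        dotProduct_sub, smul_dotProduct, dotProduct_smul, hvu, huv, hpe, hqe, smul_eq_mul]
      push_cast
      rw [← Complex.mul_conj']
      simp only [RCLike.star_def, map_div₀, Complex.conj_ofReal]
      field_simp
      ring
    rw [e] at key
    have key' : 0 ≤ q - ‖c‖ ^ 2 / p := by exact_mod_cast key
    rw [← hc]
    simpa using key'
  · intro v hv
    have hAv : (outer g + B) *ᵥ v = g := by
      rw [hv, Matrix.mulVec_mulVec, Matrix.mul_nonsing_inv _ hAd, Matrix.one_mulVec]
    have hv0 : v ≠ 0 := by
      rintro rfl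
      exact hh₁ (by simpa using hAv.symm)
    refine ⟨hv0, ?_⟩
    obtain ⟨k, hk⟩ : ∃ k : ℂ, k = 1 - star g ⬝ᵥ v := ⟨_, rfl⟩
    have hBv : B *ᵥ v = k • g := by
      rw [Matrix.add_mulVec, outer, Matrix.vecMulVec_mulVec] at hAv
      rw [hk, sub_smul, one_smul]
      refine eq_sub_of_add_eq' ?_
      simpa using hAv
    have hvk : v = k • u := by
      rw [hu, ← Matrix.mulVec_smul, ← hBv, Matrix.mulVec_mulVec, Matrix.nonsing_inv_mul _ hBd,
        Matrix.one_mulVec]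
    have hk0 : k ≠ 0 := by
      rintro rfl
      exact hv0 (by simpa using hvk)
    have hug : star u ⬝ᵥ g = (q : ℂ) := by rw [← hBu, hqe]
    have hn0 : ‖k‖ ≠ 0 := norm_ne_zero_iff.2 hk0
    have e1 : ‖star v ⬝ᵥ g‖ = ‖k‖ * q := by
      rw [hvk, star_smul, smul_dotProduct, hug]
      simp [abs_of_pos hq]
    have e2 : star v ⬝ᵥ (B *ᵥ v) = ((‖k‖ ^ 2 * q : ℝ) : ℂ) := by
      rw [hBv, hvk, star_smul, smul_dotProduct, dotProduct_smul, hug]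
      push_cast
      rw [← Complex.mul_conj']
      simp only [RCLike.star_def, smul_eq_mul]
      ring
    rw [e1, e2, Complex.ofReal_re, Complex.ofReal_re]
    field_simp
end

section
/- Let M ≥ 1, let R₁ and R₂ be M×M Hermitian positive semidefinite complex matrices, and let ρ^tr > 0 and ρ > 0 be real. Define Q = R₁ + R₂ + (1/ρ^tr) I_M, Φ_k = R_k Q^{-1} R_k for k = 1, 2, and Z = (R₁ − Φ₁) + (R₂ − Φ₂) + (1/ρ) I_M. Then for every M×M Hermitian complex matrix X, the quantity (1/M)·tr(Q^{-1} X Z^{-1} X) is real and nonnegative and satisfies (1/M)·tr(Q^{-1} X Z^{-1} X) ≥ ((1/M)·‖X‖_F²) / ((1/ρ^tr + ‖R₁ + R₂‖₂)·(1/ρ + ‖(R₁ − Φ₁) + (R₂ − Φ₂)‖₂)). -/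
open Matrix
open scoped ComplexOrder

/-- The spectral norm (largest singular value) of a complex square matrix,
realized as the operator norm on Euclidean space. -/
noncomputable def specNorm {n : ℕ} (A : Matrix (Fin n) (Fin n) ℂ) : ℝ :=
  ‖Matrix.toEuclideanCLM (𝕜 := ℂ) A‖

/-- The squared Frobenius norm `‖X‖_F² = tr(Xᴴ X)` of a complex square matrix. -/
noncomputable def frobSq {n : ℕ} (A : Matrix (Fin n) (Fin n) ℂ) : ℝ :=
  (Matrix.trace (Aᴴ * A)).re

open scoped MatrixOrder Matrix.Norms.L2Operator in
lemma aux_trace {n : ℕ} {A B : Matrix (Fin n) (Fin n) ℂ} (hA : A.PosSemidef) (hB : B.PosSemidef) :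
    0 ≤ (A * B).trace := by
  obtain ⟨C, hC⟩ := CStarAlgebra.nonneg_iff_eq_star_mul_self.mp hA.nonneg
  rw [Matrix.star_eq_conjTranspose] at hC
  subst hC
  rw [Matrix.mul_assoc, Matrix.trace_mul_comm]
  exact (hB.mul_mul_conjTranspose_same C).trace_nonneg

open scoped MatrixOrder Matrix.Norms.L2Operator in
lemma aux_norm {n : ℕ} {P : Matrix (Fin n) (Fin n) ℂ} (hP : P.PosSemidef) :
    (((specNorm P : ℝ) : ℂ) • (1 : Matrix (Fin n) (Fin n) ℂ) - P).PosSemidef := by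
  have h : P ≤ algebraMap ℝ (Matrix (Fin n) (Fin n) ℂ) ‖P‖ :=
    IsSelfAdjoint.le_algebraMap_norm_self (a := P) hP.isHermitian
  rw [Matrix.le_iff, Algebra.algebraMap_eq_smul_one] at h
  have e : ‖P‖ = specNorm P := rfl
  rw [e] at h
  have e2 : ((specNorm P : ℝ) : ℂ) • (1 : Matrix (Fin n) (Fin n) ℂ) = specNorm P • 1 := by
    ext i j; simp [Matrix.smul_apply]
  rw [e2]
  exact h

lemma aux_pd {n : ℕ} {P : Matrix (Fin n) (Fin n) ℂ} (hP : P.PosSemidef) {c : ℝ} (hc : 0 < c) :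
    (P + (c : ℂ) • (1 : Matrix (Fin n) (Fin n) ℂ)).PosDef := by
  have : ((c : ℂ) • (1 : Matrix (Fin n) (Fin n) ℂ)).PosDef :=
    Matrix.PosDef.one.smul (by exact_mod_cast hc)
  exact Matrix.PosDef.posSemidef_add hP this

lemma aux_inv {n : ℕ} {P : Matrix (Fin n) (Fin n) ℂ} (hP : P.PosSemidef) {c : ℝ} (hc : 0 < c) :
    ((P + (c : ℂ) • (1 : Matrix (Fin n) (Fin n) ℂ))⁻¹
      - (((c + specNorm P)⁻¹ : ℝ) : ℂ) • (1 : Matrix (Fin n) (Fin n) ℂ)).PosSemidef := by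
  have hA := aux_pd hP hc
  have hB := aux_norm hP
  have ht : 0 < c + specNorm P := add_pos_of_pos_of_nonneg hc (norm_nonneg _)
  set A := P + (c : ℂ) • (1 : Matrix (Fin n) (Fin n) ℂ) with hAdef
  set t := c + specNorm P with htdef
  have hBt : ((specNorm P : ℝ) : ℂ) • (1 : Matrix (Fin n) (Fin n) ℂ) - P = (t : ℂ) • 1 - A := by
    rw [hAdef, htdef]; push_cast; rw [add_smul]; abel
  rw [hBt] at hB
  have hu : IsUnit A.det := (Matrix.isUnit_iff_isUnit_det A).mp hA.isUnit
  have h1 := Matrix.mul_nonsing_inv A hu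
  have h2 := Matrix.nonsing_inv_mul A hu
  have htc : (t : ℂ) ≠ 0 := by exact_mod_cast ht.ne'
  have hk : (0 : ℂ) ≤ ((t⁻¹ ^ 2 : ℝ) : ℂ) := by exact_mod_cast sq_nonneg t⁻¹
  have key := (hB.add (hA.inv.posSemidef.mul_mul_conjTranspose_same ((t : ℂ) • 1 - A))).smul hk
  rw [hB.isHermitian.eq] at key
  convert key using 1
  have e : ((t : ℂ) • 1 - A) * A⁻¹ * ((t : ℂ) • 1 - A) = ((t : ℂ) ^ 2) • A⁻¹ - (2 * t : ℂ) • 1 + A := by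
    simp only [sub_mul, mul_sub, smul_mul_assoc, mul_smul_comm, one_mul, mul_one, h1, h2]
    module
  rw [e]
  push_cast
  match_scalars <;> field_simp <;> ring

lemma aux_phi {n : ℕ} {R Q : Matrix (Fin n) (Fin n) ℂ} (hR : R.PosSemidef) (hQ : Q.PosDef)
    (hS : (Q - R).PosSemidef) : (R - R * Q⁻¹ * R).PosSemidef := by
  have hu : IsUnit Q.det := (Matrix.isUnit_iff_isUnit_det Q).mp hQ.isUnit
  have h2 := Matrix.nonsing_inv_mul Q hu
  have key := (hR.mul_mul_conjTranspose_same (1 - R * Q⁻¹)).add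
    (hS.mul_mul_conjTranspose_same (R * Q⁻¹))
  rw [Matrix.conjTranspose_sub, Matrix.conjTranspose_one, Matrix.conjTranspose_mul,
    hR.isHermitian.eq, hQ.inv.isHermitian.eq] at key
  convert key using 1
  have e : R * Q⁻¹ * Q = R := by rw [mul_assoc, h2, mul_one]
  rw [mul_sub (R * Q⁻¹), e]
  noncomm_ring

/-- key inequality of Appendix C: with
`Q = R₁ + R₂ + (1/ρᵗʳ) I`, `Φ_k = R_k Q⁻¹ R_k`, and
`Z = (R₁ − Φ₁) + (R₂ − Φ₂) + (1/ρ) I`, for every Hermitian `X` the quantity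
`(1/M)·tr(Q⁻¹ X Z⁻¹ X)` is real, nonnegative, and at least
`((1/M)‖X‖_F²) / ((1/ρᵗʳ + ‖R₁+R₂‖₂)(1/ρ + ‖(R₁−Φ₁)+(R₂−Φ₂)‖₂))`. -/
theorem appendixC_key_inequality
    {M : ℕ} (hM : 1 ≤ M) (R₁ R₂ : Matrix (Fin M) (Fin M) ℂ)
    (hR₁ : R₁.PosSemidef) (hR₂ : R₂.PosSemidef)
    (ρtr ρ : ℝ) (hρtr : 0 < ρtr) (hρ : 0 < ρ)
    (Q Φ₁ Φ₂ Z : Matrix (Fin M) (Fin M) ℂ)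
    (hQ : Q = R₁ + R₂ + ((ρtr⁻¹ : ℝ) : ℂ) • 1)
    (hΦ₁ : Φ₁ = R₁ * Q⁻¹ * R₁) (hΦ₂ : Φ₂ = R₂ * Q⁻¹ * R₂)
    (hZ : Z = (R₁ - Φ₁) + (R₂ - Φ₂) + ((ρ⁻¹ : ℝ) : ℂ) • 1) :
    ∀ X : Matrix (Fin M) (Fin M) ℂ, X.IsHermitian →
      (Matrix.trace (Q⁻¹ * X * Z⁻¹ * X)).im = 0 ∧
      0 ≤ (1 / (M : ℝ)) * (Matrix.trace (Q⁻¹ * X * Z⁻¹ * X)).re ∧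
      ((1 / (M : ℝ)) * frobSq X) /
          ((ρtr⁻¹ + specNorm (R₁ + R₂)) * (ρ⁻¹ + specNorm ((R₁ - Φ₁) + (R₂ - Φ₂)))) ≤
        (1 / (M : ℝ)) * (Matrix.trace (Q⁻¹ * X * Z⁻¹ * X)).re := by
  have hR := hR₁.add hR₂
  have hc : 0 < ρtr⁻¹ := inv_pos.mpr hρtr
  have hd : 0 < ρ⁻¹ := inv_pos.mpr hρ
  have hQp : Q.PosDef := hQ ▸ aux_pd hR hc
  have hcI : (((ρtr⁻¹ : ℝ) : ℂ) • (1 : Matrix (Fin M) (Fin M) ℂ)).PosSemidef :=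
    Matrix.PosSemidef.one.smul (by exact_mod_cast hc.le)
  have hP1 : (R₁ - Φ₁).PosSemidef := by
    rw [hΦ₁]
    refine aux_phi hR₁ hQp ?_
    have e : Q - R₁ = R₂ + ((ρtr⁻¹ : ℝ) : ℂ) • 1 := by rw [hQ]; abel
    rw [e]; exact hR₂.add hcI
  have hP2 : (R₂ - Φ₂).PosSemidef := by
    rw [hΦ₂]
    refine aux_phi hR₂ hQp ?_
    have e : Q - R₂ = R₁ + ((ρtr⁻¹ : ℝ) : ℂ) • 1 := by rw [hQ]; abel
    rw [e]; exact hR₁.add hcI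
  have hP := hP1.add hP2
  have hZp : Z.PosDef := hZ ▸ aux_pd hP hd
  have hQi := aux_inv hR hc
  have hZi := aux_inv hP hd
  rw [← hQ] at hQi
  rw [← hZ] at hZi
  have ha : 0 < ρtr⁻¹ + specNorm (R₁ + R₂) := add_pos_of_pos_of_nonneg hc (norm_nonneg _)
  have hb : 0 < ρ⁻¹ + specNorm ((R₁ - Φ₁) + (R₂ - Φ₂)) :=
    add_pos_of_pos_of_nonneg hd (norm_nonneg _)
  set a := ρtr⁻¹ + specNorm (R₁ + R₂)
  set b := ρ⁻¹ + specNorm ((R₁ - Φ₁) + (R₂ - Φ₂))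
  intro X hX
  have hXZ : (X * Z⁻¹ * X).PosSemidef := by
    have := hZp.inv.posSemidef.mul_mul_conjTranspose_same X
    rwa [hX.eq] at this
  have t0 := aux_trace hQp.inv.posSemidef hXZ
  have t1 := aux_trace hQi hXZ
  have t2 := (hZi.mul_mul_conjTranspose_same X).trace_nonneg
  rw [hX.eq] at t2
  have e0 : Q⁻¹ * X * Z⁻¹ * X = Q⁻¹ * (X * Z⁻¹ * X) := by simp only [mul_assoc]
  rw [e0]
  simp only [sub_mul, mul_sub, smul_mul_assoc, mul_smul_comm, one_mul, mul_one,
    Matrix.trace_sub, Matrix.trace_smul, smul_eq_mul] at t1 t2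
  have r0 := (Complex.le_def.mp t0)
  have r1 := (Complex.le_def.mp t1).1
  have r2 := (Complex.le_def.mp t2).1
  simp only [Complex.sub_re, Complex.re_ofReal_mul, Complex.zero_re] at r1 r2
  have hM0 : (0 : ℝ) ≤ 1 / (M : ℝ) := by positivity
  refine ⟨r0.2.symm, mul_nonneg hM0 r0.1, ?_⟩
  rw [mul_div_assoc]
  refine mul_le_mul_of_nonneg_left ?_ hM0
  unfold frobSq
  rw [hX.eq]
  have := mul_le_mul_of_nonneg_left (sub_nonneg.mp r2) (inv_pos.mpr ha).le
  calc _ = a⁻¹ * (b⁻¹ * (X * X).trace.re) := by field_simp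
    _ ≤ _ := this
    _ ≤ _ := sub_nonneg.mp r1
end

section
/- For each M ≥ 1 let R₁^{(M)} and R₂^{(M)} be M×M Hermitian positive semidefinite complex matrices, and let ρ^tr > 0 and ρ > 0 be real. Define Q^{(M)} = R₁^{(M)} + R₂^{(M)} + (1/ρ^tr) I_M, Φ_k^{(M)} = R_k^{(M)} (Q^{(M)})^{-1} R_k^{(M)} for k = 1, 2, and Z^{(M)} = (R₁^{(M)} − Φ₁^{(M)}) + (R₂^{(M)} − Φ₂^{(M)}) + (1/ρ) I_M. Assume limsup_{M→∞} ‖R_k^{(M)}‖₂ < ∞ for k = 1, 2. If liminf_{M→∞} inf_{λ∈ℝ} (1/M)·‖R₁^{(M)} − λ R₂^{(M)}‖_F² > 0, then liminf_{M→∞} inf_{λ∈ℝ} (1/M)·Re tr((Q^{(M)})^{-1} (R₁^{(M)} − λ R₂^{(M)}) (Z^{(M)})^{-1} (R₁^{(M)} − λ R₂^{(M)})) > 0. -/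
open Matrix Filter
open scoped ComplexOrder

open Matrix Filter
open scoped ComplexOrder

section helpers
variable {n : ℕ}

open scoped Matrix.Norms.L2Operator MatrixOrder in
lemma aux_norm_le {A : Matrix (Fin n) (Fin n) ℂ} (hA : A.PosSemidef) {c : ℝ}
    (h : specNorm A ≤ c) : ((c : ℂ) • (1 : Matrix (Fin n) (Fin n) ℂ) - A).PosSemidef := by
  have h1 : ‖A‖ ≤ c := h
  have h2 : A ≤ algebraMap ℝ _ ‖A‖ := IsSelfAdjoint.le_algebraMap_norm_self (a := A) hA.1
  have h3 := (Matrix.le_iff).1 h2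
  have h4 : ((((c - ‖A‖ : ℝ)) : ℂ) • (1 : Matrix (Fin n) (Fin n) ℂ)).PosSemidef :=
    Matrix.PosSemidef.one.smul (by exact_mod_cast sub_nonneg.2 h1)
  have h5 := h4.add h3
  convert h5 using 1
  rw [Algebra.algebraMap_eq_smul_one, ← Complex.coe_smul]
  push_cast
  rw [sub_smul]; abel

lemma aux_scal {c : ℝ} (h : 0 < c) : ((c : ℂ) • (1 : Matrix (Fin n) (Fin n) ℂ)).PosDef :=
  Matrix.PosDef.one.smul (by exact_mod_cast h)

lemma aux_inv_s7 {A : Matrix (Fin n) (Fin n) ℂ} (hA : A.PosDef) {a : ℝ} (ha : 0 < a)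
    (h : ((a : ℂ) • (1 : Matrix (Fin n) (Fin n) ℂ) - A).PosSemidef) :
    (A⁻¹ - ((a⁻¹ : ℝ) : ℂ) • (1 : Matrix (Fin n) (Fin n) ℂ)).PosSemidef := by
  set B := A⁻¹ with hB
  have hu : IsUnit A.det := (Matrix.isUnit_iff_isUnit_det _).1 hA.isUnit
  have hAB : A * B = 1 := Matrix.mul_nonsing_inv _ hu
  have hBA : B * A = 1 := Matrix.nonsing_inv_mul _ hu
  set t : ℂ := ((a⁻¹ : ℝ) : ℂ) with ht
  have hta : t * a = 1 := by rw [ht]; push_cast; field_simp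
  have ht0 : 0 ≤ t ^ 2 := by rw [ht]; exact_mod_cast sq_nonneg (a⁻¹)
  have hD : (B - t • (1 : Matrix (Fin n) (Fin n) ℂ)).IsHermitian := by
    refine hA.inv.1.sub ?_
    exact (aux_scal (inv_pos.2 ha)).1
  have h1 := hA.posSemidef.mul_mul_conjTranspose_same (B - t • (1 : Matrix (Fin n) (Fin n) ℂ))
  rw [hD.eq] at h1
  have h2 := h1.add (h.smul ht0)
  convert h2 using 1
  simp only [sub_mul, mul_sub, hAB, hBA, smul_mul_assoc, mul_smul_comm, one_mul, mul_one,
    smul_sub, smul_smul]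
  have : t ^ 2 * a = t := by rw [sq, mul_assoc, hta, mul_one]
  rw [this, sq]; abel

lemma aux_schur {R Q : Matrix (Fin n) (Fin n) ℂ} (hR : R.PosSemidef) (hQ : Q.PosDef)
    (h : (Q - R).PosSemidef) : (R - R * Q⁻¹ * R).PosSemidef := by
  set B := Q⁻¹ with hB
  have hu : IsUnit Q.det := (Matrix.isUnit_iff_isUnit_det _).1 hQ.isUnit
  have hBA : B * Q = 1 := Matrix.nonsing_inv_mul _ hu
  have hBH : Bᴴ = B := hQ.inv.1
  have h1 := hR.mul_mul_conjTranspose_same (1 - R * B)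
  have h2 := h.mul_mul_conjTranspose_same (R * B)
  simp only [conjTranspose_sub, conjTranspose_mul, conjTranspose_one, hBH, hR.1.eq] at h1 h2
  convert h1.add h2 using 1
  have : R * B * Q * (B * R) = R * B * R := by
    rw [mul_assoc R B Q, hBA, mul_one, mul_assoc]
  rw [mul_sub (R * B), sub_mul _ _ (B * R), this]
  noncomm_ring

open scoped Matrix.Norms.L2Operator MatrixOrder in
lemma aux_tr {A B : Matrix (Fin n) (Fin n) ℂ} (hA : A.PosSemidef) (hB : B.PosSemidef) :
    0 ≤ (A * B).trace.re := by
  obtain ⟨C, rfl⟩ := CStarAlgebra.nonneg_iff_eq_star_mul_self.mp hA.nonneg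
  rw [Matrix.star_eq_conjTranspose]
  rw [mul_assoc, Matrix.trace_mul_comm]
  exact (Complex.le_def.1 (hB.mul_mul_conjTranspose_same C).trace_nonneg).1

lemma aux_main {Q Z X : Matrix (Fin n) (Fin n) ℂ} (hX : X.IsHermitian) {q z : ℝ}
    (hq : 0 < q) (hz : 0 < z) (hQ : Q.PosDef) (hZ : Z.PosDef)
    (hQ' : ((q : ℂ) • (1 : Matrix (Fin n) (Fin n) ℂ) - Q).PosSemidef)
    (hZ' : ((z : ℂ) • (1 : Matrix (Fin n) (Fin n) ℂ) - Z).PosSemidef) :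
    q⁻¹ * z⁻¹ * frobSq X ≤ (Q⁻¹ * X * Z⁻¹ * X).trace.re := by
  have h1 := hZ.inv.posSemidef.mul_mul_conjTranspose_same X
  have h2 := (aux_inv_s7 hZ hz hZ').mul_mul_conjTranspose_same X
  have h3 := aux_tr (aux_inv_s7 hQ hq hQ') h1
  have h4 := (Complex.le_def.1 h2.trace_nonneg).1
  unfold frobSq
  rw [hX.eq] at *
  simp only [sub_mul, mul_sub, smul_mul_assoc, mul_smul_comm, one_mul, mul_one, trace_sub,
    trace_smul, Complex.sub_re, smul_eq_mul, Complex.re_ofReal_mul, Complex.zero_re,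
    ← mul_assoc] at h3 h4
  have := mul_le_mul_of_nonneg_left (sub_nonneg.1 h4) (inv_pos.2 hq).le
  linarith

end helpers

/-- Corollary 1 of the paper: for a sequence of `M×M` Hermitian
positive semidefinite covariance matrices `R₁⁽ᴹ⁾`, `R₂⁽ᴹ⁾` with uniformly bounded
spectral norms (`limsup_M ‖R_k⁽ᴹ⁾‖₂ < ∞`), if the asymptotic linear-independence
condition `liminf_M inf_λ (1/M)‖R₁⁽ᴹ⁾ − λR₂⁽ᴹ⁾‖_F² > 0` holds, then Assumption 2
holds: `liminf_M inf_λ (1/M)·Re tr(Q⁻¹(R₁−λR₂)Z⁻¹(R₁−λR₂)) > 0`, where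
`Q = R₁ + R₂ + (1/ρᵗʳ)I`, `Φ_k = R_k Q⁻¹ R_k`, `Z = (R₁−Φ₁)+(R₂−Φ₂)+(1/ρ)I`. -/
theorem frobenius_linear_independence_implies_assumption2
    (R₁ R₂ : (M : ℕ) → Matrix (Fin M) (Fin M) ℂ)
    (hR₁ : ∀ M, (R₁ M).PosSemidef) (hR₂ : ∀ M, (R₂ M).PosSemidef)
    (ρtr ρ : ℝ) (hρtr : 0 < ρtr) (hρ : 0 < ρ)
    (Q Φ₁ Φ₂ Z : (M : ℕ) → Matrix (Fin M) (Fin M) ℂ)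
    (hQ : ∀ M, Q M = R₁ M + R₂ M + ((ρtr⁻¹ : ℝ) : ℂ) • 1)
    (hΦ₁ : ∀ M, Φ₁ M = R₁ M * (Q M)⁻¹ * R₁ M)
    (hΦ₂ : ∀ M, Φ₂ M = R₂ M * (Q M)⁻¹ * R₂ M)
    (hZ : ∀ M, Z M = (R₁ M - Φ₁ M) + (R₂ M - Φ₂ M) + ((ρ⁻¹ : ℝ) : ℂ) • 1)
    (hbound₁ : ∃ C : ℝ, ∀ M, specNorm (R₁ M) ≤ C)
    (hbound₂ : ∃ C : ℝ, ∀ M, specNorm (R₂ M) ≤ C)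
    (hindep : ∃ ε > (0 : ℝ), ∀ᶠ M : ℕ in atTop,
      ε ≤ ⨅ l : ℝ, (1 / (M : ℝ)) * frobSq (R₁ M - (l : ℂ) • R₂ M)) :
    ∃ ε > (0 : ℝ), ∀ᶠ M : ℕ in atTop,
      ε ≤ ⨅ l : ℝ, (1 / (M : ℝ)) *
        (Matrix.trace ((Q M)⁻¹ * (R₁ M - (l : ℂ) • R₂ M) * (Z M)⁻¹ *
          (R₁ M - (l : ℂ) • R₂ M))).re := by
  obtain ⟨C₁, hC₁⟩ := hbound₁
  obtain ⟨C₂, hC₂⟩ := hbound₂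
  obtain ⟨ε, hε, hev⟩ := hindep
  have hn : ∀ {n : ℕ} (A : Matrix (Fin n) (Fin n) ℂ), 0 ≤ specNorm A := fun A => norm_nonneg _
  have hC₁0 : 0 ≤ C₁ := (hn _).trans (hC₁ 0)
  have hC₂0 : 0 ≤ C₂ := (hn _).trans (hC₂ 0)
  have hti : 0 < ρtr⁻¹ := inv_pos.2 hρtr
  have hri : 0 < ρ⁻¹ := inv_pos.2 hρ
  have hq : 0 < C₁ + C₂ + ρtr⁻¹ := by positivity
  have hz : 0 < C₁ + C₂ + ρ⁻¹ := by positivity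
  refine ⟨(C₁ + C₂ + ρtr⁻¹)⁻¹ * (C₁ + C₂ + ρ⁻¹)⁻¹ * ε, by positivity, ?_⟩
  filter_upwards [hev] with M hM
  have b₁ := aux_norm_le (hR₁ M) (hC₁ M)
  have b₂ := aux_norm_le (hR₂ M) (hC₂ M)
  have hQd : (Q M).PosDef := by
    rw [hQ]; exact Matrix.PosDef.posSemidef_add ((hR₁ M).add (hR₂ M)) (aux_scal hti)
  have s₁ : (R₁ M - Φ₁ M).PosSemidef := by
    rw [hΦ₁]
    refine aux_schur (hR₁ M) hQd ?_
    convert (hR₂ M).add (aux_scal (n := M) hti).posSemidef using 1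
    rw [hQ]; abel
  have s₂ : (R₂ M - Φ₂ M).PosSemidef := by
    rw [hΦ₂]
    refine aux_schur (hR₂ M) hQd ?_
    convert (hR₁ M).add (aux_scal (n := M) hti).posSemidef using 1
    rw [hQ]; abel
  have p₁ : (Φ₁ M).PosSemidef := by
    have := hQd.inv.posSemidef.mul_mul_conjTranspose_same (R₁ M)
    rwa [(hR₁ M).1.eq, ← hΦ₁] at this
  have p₂ : (Φ₂ M).PosSemidef := by
    have := hQd.inv.posSemidef.mul_mul_conjTranspose_same (R₂ M)
    rwa [(hR₂ M).1.eq, ← hΦ₂] at this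
  have hZd : (Z M).PosDef := by
    rw [hZ]; exact Matrix.PosDef.posSemidef_add (s₁.add s₂) (aux_scal hri)
  have hQ' : (((C₁ + C₂ + ρtr⁻¹ : ℝ) : ℂ) • (1 : Matrix (Fin M) (Fin M) ℂ) - Q M).PosSemidef := by
    convert b₁.add b₂ using 1
    rw [hQ, Complex.ofReal_add, Complex.ofReal_add, add_smul, add_smul]; abel
  have hZ' : (((C₁ + C₂ + ρ⁻¹ : ℝ) : ℂ) • (1 : Matrix (Fin M) (Fin M) ℂ) - Z M).PosSemidef := by
    convert (b₁.add b₂).add (p₁.add p₂) using 1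
    rw [hZ, Complex.ofReal_add, Complex.ofReal_add, add_smul, add_smul]; abel
  refine le_ciInf fun l => ?_
  have hX : (R₁ M - (l : ℂ) • R₂ M).IsHermitian := by
    refine (hR₁ M).1.sub ?_
    rw [Matrix.IsHermitian, conjTranspose_smul, (hR₂ M).1.eq]
    simp
  have key := aux_main hX hq hz hQd hZd hQ' hZ'
  have hM0 : 0 ≤ 1 / (M : ℝ) := by positivity
  have hl : ε ≤ 1 / (M : ℝ) * frobSq (R₁ M - (l : ℂ) • R₂ M) := by
    refine hM.trans (ciInf_le ⟨0, ?_⟩ l)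
    rintro _ ⟨k, rfl⟩
    refine mul_nonneg hM0 ?_
    exact (Complex.le_def.1
      (Matrix.posSemidef_conjTranspose_mul_self (R₁ M - (k : ℂ) • R₂ M)).trace_nonneg).1
  have hk := mul_le_mul_of_nonneg_left key hM0
  have hl' := mul_le_mul_of_nonneg_left hl
    (mul_pos (inv_pos.2 hq) (inv_pos.2 hz)).le
  linarith
end

section
/- Let R₁ and R₂ be M×M Hermitian positive semidefinite complex matrices with R₁ R₂ = 0, and let c > 0 be real. Then R₁ (R₁ + R₂ + c·I_M)^{-1} R₂ = 0. -/
open Matrix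
open scoped ComplexOrder

/-- if the Hermitian positive semidefinite covariance matrices
`R₁`, `R₂` have orthogonal support (`R₁ R₂ = 0`) and `c > 0`, then the estimate
correlation matrix `Υ₁₂ = R₁ (R₁ + R₂ + c·I)⁻¹ R₂` is zero. -/
theorem orthogonal_support_no_pilot_contamination
    {M : ℕ} (R₁ R₂ : Matrix (Fin M) (Fin M) ℂ)
    (hR₁ : R₁.PosSemidef) (hR₂ : R₂.PosSemidef) (horth : R₁ * R₂ = 0)
    (c : ℝ) (hc : 0 < c) :
    R₁ * (R₁ + R₂ + (c : ℂ) • 1)⁻¹ * R₂ = 0 := by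
  have h21 : R₂ * R₁ = 0 := by
    have h := congrArg conjTranspose horth
    rwa [conjTranspose_mul, hR₁.isHermitian.eq, hR₂.isHermitian.eq, conjTranspose_zero] at h
  generalize hQ : R₁ + R₂ + (c : ℂ) • (1 : Matrix (Fin M) (Fin M) ℂ) = Q
  have hcomm : R₁ * Q = Q * R₁ := by
    rw [← hQ]
    simp [mul_add, add_mul, horth, h21]
  by_cases hu : IsUnit Q.det
  · have h : R₁ * Q⁻¹ = Q⁻¹ * R₁ := by
      calc R₁ * Q⁻¹ = Q⁻¹ * Q * R₁ * Q⁻¹ := by rw [nonsing_inv_mul Q hu, one_mul]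
        _ = Q⁻¹ * (R₁ * Q) * Q⁻¹ := by rw [hcomm]; simp only [mul_assoc]
        _ = Q⁻¹ * R₁ * (Q * Q⁻¹) := by simp only [mul_assoc]
        _ = Q⁻¹ * R₁ := by rw [mul_nonsing_inv Q hu, mul_one]
    rw [h, mul_assoc, horth, mul_zero]
  · rw [nonsing_inv_apply_not_isUnit Q hu, mul_zero, zero_mul]
end

section
/- For each M ≥ 1 let R₁^{(M)} and R₂^{(M)} be M×M Hermitian positive semidefinite complex matrices, and let ρ^tr > 0 and ρ > 0 be real. Define Q^{(M)} = R₁^{(M)} + R₂^{(M)} + (1/ρ^tr) I_M, Φ_k^{(M)} = R_k^{(M)} (Q^{(M)})^{-1} R_k^{(M)} for k = 1, 2, Z^{(M)} = (R₁^{(M)} − Φ₁^{(M)}) + (R₂^{(M)} − Φ₂^{(M)}) + (1/ρ) I_M, and set β₁₁(M) = (1/M)·Re tr((Q^{(M)})^{-1} R₁^{(M)} (Z^{(M)})^{-1} R₁^{(M)}), β₂₂(M) = (1/M)·Re tr((Q^{(M)})^{-1} R₂^{(M)} (Z^{(M)})^{-1} R₂^{(M)}), β₁₂(M) = (1/M)·tr((Q^{(M)})^{-1}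 R₁^{(M)} (Z^{(M)})^{-1} R₂^{(M)}). Assume (Assumption 1) liminf_{M→∞} (1/M)·tr(R_k^{(M)}) > 0 and limsup_{M→∞} ‖R_k^{(M)}‖₂ < ∞ for k = 1, 2, and assume (Assumption 2) liminf_{M→∞} inf_{λ∈ℝ} (1/M)·Re tr((Q^{(M)})^{-1} (R₁^{(M)} − λ R₂^{(M)}) (Z^{(M)})^{-1} (R₁^{(M)} − λ R₂^{(M)})) > 0. Then there exists M₀ such that β₂₂(M) > 0 for all M ≥ M₀, and liminf_{M→∞} (β₁₁(M) − (Re β₁₂(M))²/β₂₂(M)) > 0. -/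
open Matrix Filter
open scoped ComplexOrder

open scoped MatrixOrder in
lemma aux_factor {n : ℕ} {A : Matrix (Fin n) (Fin n) ℂ} (hA : A.PosDef) :
    ∃ B : Matrix (Fin n) (Fin n) ℂ, IsUnit B ∧ A = Bᴴ * B := by
  obtain ⟨B, hB⟩ := CStarAlgebra.nonneg_iff_eq_star_mul_self.mp hA.posSemidef.nonneg
  refine ⟨B, ?_, hB⟩
  have h := hA.isUnit
  rw [Matrix.isUnit_iff_isUnit_det, hB, Matrix.det_mul] at h
  rw [Matrix.isUnit_iff_isUnit_det]
  exact isUnit_of_mul_isUnit_right h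

lemma aux_trace_pos {n : ℕ} {A B R : Matrix (Fin n) (Fin n) ℂ} (hA : A.PosDef) (hB : B.PosDef)
    (hR : R.IsHermitian) (h0 : R ≠ 0) : 0 < (Matrix.trace (A * R * B * R)).re := by
  obtain ⟨D, hD, rfl⟩ := aux_factor hA
  obtain ⟨E, hE, rfl⟩ := aux_factor hB
  have hE' : IsUnit Eᴴ := by simpa [Matrix.star_eq_conjTranspose] using hE.star
  have key : Matrix.trace (Dᴴ * D * R * (Eᴴ * E) * R)
      = Matrix.trace ((D * R * Eᴴ) * (D * R * Eᴴ)ᴴ) := by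
    simp only [Matrix.conjTranspose_mul, Matrix.conjTranspose_conjTranspose, hR.eq]
    rw [show Dᴴ * D * R * (Eᴴ * E) * R = Dᴴ * (D * R * Eᴴ * (E * R)) by
      simp only [Matrix.mul_assoc], Matrix.trace_mul_comm]
    simp only [Matrix.mul_assoc]
  have hne : Matrix.trace ((D * R * Eᴴ) * (D * R * Eᴴ)ᴴ) ≠ 0 := by
    rw [Ne, Matrix.trace_mul_conjTranspose_self_eq_zero_iff]
    intro h
    rw [hE'.mul_left_eq_zero, hD.mul_right_eq_zero] at h
    exact h0 h
  have hnn := (Matrix.posSemidef_self_mul_conjTranspose (D * R * Eᴴ)).trace_nonneg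
  rw [key]
  exact (Complex.pos_iff.mp (lt_of_le_of_ne hnn hne.symm)).1

lemma aux_psd {n : ℕ} {Q R S : Matrix (Fin n) (Fin n) ℂ} (hQ : Q.PosDef) (hR : R.PosSemidef)
    (hS : S.PosSemidef) (h : Q = R + S) : (R - R * Q⁻¹ * R).PosSemidef := by
  have hd : IsUnit Q.det := (Matrix.isUnit_iff_isUnit_det _).mp hQ.isUnit
  have h1 : Q⁻¹ * Q = 1 := Matrix.nonsing_inv_mul _ hd
  have h2 : Q * Q⁻¹ = 1 := Matrix.mul_nonsing_inv _ hd
  have hS' : S = Q - R := by rw [h]; abel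
  have hP : (Q⁻¹)ᴴ = Q⁻¹ := hQ.inv.isHermitian.eq
  have e : R - R * Q⁻¹ * R = (R * Q⁻¹) * S * (R * Q⁻¹)ᴴ + (S * Q⁻¹) * R * (S * Q⁻¹)ᴴ := by
    simp only [Matrix.conjTranspose_mul, hP, hR.isHermitian.eq, hS.isHermitian.eq]
    rw [hS']
    simp only [Matrix.mul_sub, Matrix.sub_mul, Matrix.mul_assoc, h1, h2, Matrix.mul_one, Matrix.one_mul]
    abel
  rw [e]
  exact (hS.mul_mul_conjTranspose_same _).add (hR.mul_mul_conjTranspose_same _)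

lemma aux_smul_one {n : ℕ} {r : ℝ} (hr : 0 < r) :
    (((r⁻¹ : ℝ) : ℂ) • (1 : Matrix (Fin n) (Fin n) ℂ)).PosDef :=
  Matrix.PosDef.one.smul (by simpa using hr)

lemma aux_expand {n : ℕ} {A B R S : Matrix (Fin n) (Fin n) ℂ} (hA : A.IsHermitian)
    (hB : B.IsHermitian) (hR : R.IsHermitian) (hS : S.IsHermitian) (l : ℝ) :
    (Matrix.trace (A * (R - (l : ℂ) • S) * B * (R - (l : ℂ) • S))).re
      = (Matrix.trace (A * R * B * R)).re - 2 * l * (Matrix.trace (A * R * B * S)).re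
        + l ^ 2 * (Matrix.trace (A * S * B * S)).re := by
  have hs : (Matrix.trace (A * S * B * R)).re = (Matrix.trace (A * R * B * S)).re := by
    have : Matrix.trace (A * S * B * R) = star (Matrix.trace (A * R * B * S)) := by
      rw [← Matrix.trace_conjTranspose]
      simp only [Matrix.conjTranspose_mul, hA.eq, hB.eq, hR.eq, hS.eq]
      rw [show S * (B * (R * A)) = (S * B * R) * A by simp only [Matrix.mul_assoc],
        Matrix.trace_mul_comm (S * B * R) A]
      simp only [Matrix.mul_assoc]
    rw [this]; simp
  simp only [Matrix.mul_sub, Matrix.sub_mul, Matrix.mul_smul, Matrix.smul_mul, Matrix.trace_sub,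
    Matrix.trace_smul, Complex.sub_re, smul_eq_mul, Complex.re_ofReal_mul, hs]
  ring

/-- deterministic core of Theorem 1, Appendix B: with
`Q = R₁ + R₂ + (1/ρᵗʳ)I`, `Φ_k = R_k Q⁻¹ R_k`, `Z = (R₁−Φ₁)+(R₂−Φ₂)+(1/ρ)I`,
`β₁₁ = (1/M)Re tr(Q⁻¹R₁Z⁻¹R₁)`, `β₂₂ = (1/M)Re tr(Q⁻¹R₂Z⁻¹R₂)`,
`β₁₂ = (1/M)tr(Q⁻¹R₁Z⁻¹R₂)`, under Assumption 1
(`liminf (1/M)tr(R_k) > 0`, `limsup ‖R_k‖₂ < ∞`) and Assumption 2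
(`liminf inf_λ (1/M)Re tr(Q⁻¹(R₁−λR₂)Z⁻¹(R₁−λR₂)) > 0`), the coefficient `β₂₂`
is eventually positive and `δ = β₁₁ − (Re β₁₂)²/β₂₂` satisfies `liminf δ > 0`. -/
theorem theorem1_delta_bounded_away_from_zero
    (R₁ R₂ : (M : ℕ) → Matrix (Fin M) (Fin M) ℂ)
    (hR₁ : ∀ M, (R₁ M).PosSemidef) (hR₂ : ∀ M, (R₂ M).PosSemidef)
    (ρtr ρ : ℝ) (hρtr : 0 < ρtr) (hρ : 0 < ρ)
    (Q Φ₁ Φ₂ Z : (M : ℕ) → Matrix (Fin M) (Fin M) ℂ)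
    (hQ : ∀ M, Q M = R₁ M + R₂ M + ((ρtr⁻¹ : ℝ) : ℂ) • 1)
    (hΦ₁ : ∀ M, Φ₁ M = R₁ M * (Q M)⁻¹ * R₁ M)
    (hΦ₂ : ∀ M, Φ₂ M = R₂ M * (Q M)⁻¹ * R₂ M)
    (hZ : ∀ M, Z M = (R₁ M - Φ₁ M) + (R₂ M - Φ₂ M) + ((ρ⁻¹ : ℝ) : ℂ) • 1)
    (β₁₁ β₂₂ : ℕ → ℝ) (β₁₂ : ℕ → ℂ)
    (hβ₁₁ : ∀ M, β₁₁ M =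
      (1 / (M : ℝ)) * (Matrix.trace ((Q M)⁻¹ * R₁ M * (Z M)⁻¹ * R₁ M)).re)
    (hβ₂₂ : ∀ M, β₂₂ M =
      (1 / (M : ℝ)) * (Matrix.trace ((Q M)⁻¹ * R₂ M * (Z M)⁻¹ * R₂ M)).re)
    (hβ₁₂ : ∀ M, β₁₂ M =
      (1 / (M : ℂ)) * Matrix.trace ((Q M)⁻¹ * R₁ M * (Z M)⁻¹ * R₂ M))
    -- Assumption 1
    (htrace₁ : ∃ ε > (0 : ℝ), ∀ᶠ M : ℕ in atTop,
      ε ≤ (1 / (M : ℝ)) * (Matrix.trace (R₁ M)).re)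
    (htrace₂ : ∃ ε > (0 : ℝ), ∀ᶠ M : ℕ in atTop,
      ε ≤ (1 / (M : ℝ)) * (Matrix.trace (R₂ M)).re)
    (hbound₁ : ∃ C : ℝ, ∀ M, specNorm (R₁ M) ≤ C)
    (hbound₂ : ∃ C : ℝ, ∀ M, specNorm (R₂ M) ≤ C)
    -- Assumption 2
    (hassump2 : ∃ ε > (0 : ℝ), ∀ᶠ M : ℕ in atTop,
      ε ≤ ⨅ l : ℝ, (1 / (M : ℝ)) *
        (Matrix.trace ((Q M)⁻¹ * (R₁ M - (l : ℂ) • R₂ M) * (Z M)⁻¹ *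
          (R₁ M - (l : ℂ) • R₂ M))).re) :
    (∃ M₀ : ℕ, ∀ M ≥ M₀, 0 < β₂₂ M) ∧
    (∃ δ > (0 : ℝ), ∀ᶠ M : ℕ in atTop,
      δ ≤ β₁₁ M - ((β₁₂ M).re) ^ 2 / β₂₂ M) := by
  have hQd : ∀ M, (Q M).PosDef := fun M => by
    rw [hQ]
    exact Matrix.PosDef.posSemidef_add ((hR₁ M).add (hR₂ M)) (aux_smul_one hρtr)
  have hZd : ∀ M, (Z M).PosDef := fun M => by
    rw [hZ, hΦ₁, hΦ₂]
    refine Matrix.PosDef.posSemidef_add (Matrix.PosSemidef.add ?_ ?_) (aux_smul_one hρ)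
    · exact aux_psd (hQd M) (hR₁ M) ((hR₂ M).add (aux_smul_one hρtr).posSemidef)
        (by rw [hQ, add_assoc])
    · exact aux_psd (hQd M) (hR₂ M) ((hR₁ M).add (aux_smul_one hρtr).posSemidef)
        (by rw [hQ]; abel)
  constructor
  · obtain ⟨ε, hε, h⟩ := htrace₂
    obtain ⟨M₀, hM₀⟩ := eventually_atTop.mp h
    refine ⟨M₀ + 1, fun M hM => ?_⟩
    have h1 := hM₀ M (by omega)
    have hMpos : (0 : ℝ) < M := by exact_mod_cast (by omega : 0 < M)
    rw [hβ₂₂]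
    refine mul_pos (by positivity) (aux_trace_pos (hQd M).inv (hZd M).inv (hR₂ M).isHermitian ?_)
    intro h0
    rw [h0] at h1
    simp at h1
    linarith
  · obtain ⟨ε, hε, h⟩ := hassump2
    refine ⟨ε, hε, h.mono fun M hM => ?_⟩
    have hb : ∀ l : ℝ, ε ≤ β₁₁ M - 2 * l * (β₁₂ M).re + l ^ 2 * β₂₂ M := by
      intro l
      have hbdd : BddBelow (Set.range fun l : ℝ => (1 / (M : ℝ)) *
        (Matrix.trace ((Q M)⁻¹ * (R₁ M - (l : ℂ) • R₂ M) * (Z M)⁻¹ *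
          (R₁ M - (l : ℂ) • R₂ M))).re) := by
        by_contra hn
        rw [Real.iInf_of_not_bddBelow hn] at hM
        linarith
      have h2 := hM.trans (ciInf_le hbdd l)
      rw [aux_expand (hQd M).inv.isHermitian (hZd M).inv.isHermitian (hR₁ M).isHermitian
        (hR₂ M).isHermitian] at h2
      have h3 : (β₁₂ M).re =
          (1 / (M : ℝ)) * (Matrix.trace ((Q M)⁻¹ * R₁ M * (Z M)⁻¹ * R₂ M)).re := by
        rw [hβ₁₂, ← Complex.re_ofReal_mul]
        push_cast
        rfl
      rw [h3, hβ₁₁, hβ₂₂]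
      linarith
    have h4 := hb ((β₁₂ M).re / β₂₂ M)
    refine h4.trans (le_of_eq ?_)
    by_cases hz : β₂₂ M = 0
    · simp [hz]
    · field_simp
      ring
end
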